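/- arXiv:1709.01045 — 2 statements merged into one kernel-verified Lean document; each statement's English description precedes it below -/
import Mathlib

section
/- Let p ∈ ℝ and let v, f : ℝ → ℝ be real-analytic at p with f(p) = p and f'(p) ≠ 0. Assume that the derivative v' is not identically zero on any neighbourhood of p (equivalently, it is not the case that v'(x) = 0 for all x in some neighbourhood of p). Then there exists a real number L ≠ 0 such that the function x ↦ v'(x) / v'(f(x)) tends to L as x tends to p within ℝ \ {p}. -/
open Filter Topology

/-- If `v` and `f` are real-analytic at `p`, `f p = p`, `f' p ≠ 0`, and `v'`
does not vanish identically on any neighbourhood of `p`, then `x ↦ v'(x)/v'(f x)` tends to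
some nonzero limit `L` as `x → p` within `ℝ \ {p}`. -/
theorem universal_function_nonzero_limit
    (p : ℝ) (v f : ℝ → ℝ)
    (hv : AnalyticAt ℝ v p) (hf : AnalyticAt ℝ f p)
    (hfp : f p = p) (hf' : deriv f p ≠ 0)
    (hv' : ¬ ∀ᶠ x in 𝓝 p, deriv v x = 0) :
    ∃ L : ℝ, L ≠ 0 ∧
      Tendsto (fun x => deriv v x / deriv v (f x)) (𝓝[≠] p) (𝓝 L) := by
  obtain ⟨n, g, hg, hgp, hvg⟩ := hv.deriv.exists_eventuallyEq_pow_smul_nonzero_iff.mpr hv'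
  have hfc : Tendsto f (𝓝 p) (𝓝 p) := by simpa [hfp] using hf.continuousAt.tendsto
  have hslope : Tendsto (slope f p) (𝓝[≠] p) (𝓝 (deriv f p)) :=
    hasDerivAt_iff_tendsto_slope.mp hf.differentiableAt.hasDerivAt
  have hgc : Tendsto g (𝓝 p) (𝓝 (g p)) := hg.continuousAt.tendsto
  refine ⟨(deriv f p ^ n)⁻¹ * (g p / g p),
    mul_ne_zero (inv_ne_zero (pow_ne_zero n hf')) (div_ne_zero hgp hgp), ?_⟩
  have hlim : Tendsto (fun x => (slope f p x ^ n)⁻¹ * (g x / g (f x))) (𝓝[≠] p)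
      (𝓝 ((deriv f p ^ n)⁻¹ * (g p / g p))) :=
    ((hslope.pow n).inv₀ (pow_ne_zero n hf')).mul
      ((hgc.div (hgc.comp hfc) hgp).mono_left nhdsWithin_le_nhds)
  refine hlim.congr' ?_
  filter_upwards [nhdsWithin_le_nhds hvg, nhdsWithin_le_nhds (hfc.eventually hvg)]
    with x hx hfx
  rw [hx, hfx, slope_def_field, hfp, smul_eq_mul, smul_eq_mul, div_pow, inv_div,
    div_mul_div_comm]
end

section
/- Let M : ℝ → Matrix (Fin 2) (Fin 2) ℝ be a family of 2×2 real matrices whose entries are differentiable at b₀, and let λ : ℝ → ℝ be differentiable at b₀ with det(M(b) − λ(b)·I) = 0 for all b in some neighbourhood of b₀. Set T(b) = tr M(b) and D(b) = det M(b), and assume 2λ(b₀) ≠ T(b₀). Then λ'(b₀) = 0 if and only if λ(b₀) · T'(b₀) = D'(b₀). -/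
open Filter Topology Matrix

/-- The characteristic equation of a `2 × 2` matrix in terms of its trace and determinant. -/
theorem det_sub_smul_one_fin_two {R : Type*} [CommRing R] (A : Matrix (Fin 2) (Fin 2) R) (c : R) :
    (A - c • (1 : Matrix (Fin 2) (Fin 2) R)).det = c ^ 2 - A.trace * c + A.det := by
  simp [Matrix.det_fin_two, Matrix.trace_fin_two]
  ring

/-- Implicit differentiation of a root of a monic quadratic with differentiable coefficients. -/
theorem deriv_root_quadratic {T D r : ℝ → ℝ} {x : ℝ} (hT : DifferentiableAt ℝ T x)
    (hD : DifferentiableAt ℝ D x) (hr : DifferentiableAt ℝ r x)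
    (h : ∀ᶠ y in 𝓝 x, r y ^ 2 - T y * r y + D y = 0) :
    (2 * r x - T x) * deriv r x = r x * deriv T x - deriv D x := by
  have hderiv := ((hr.hasDerivAt.pow 2).sub (hT.hasDerivAt.mul hr.hasDerivAt)).add hD.hasDerivAt
  have hzero := hderiv.unique ((hasDerivAt_const x (0 : ℝ)).congr_of_eventuallyEq h)
  norm_num at hzero
  linear_combination hzero

/-- for a differentiable family of 2×2 matrices with a differentiable simple
eigenvalue branch `λ` (i.e. `2λ(b₀) ≠ T(b₀)`), one has
`λ'(b₀) = 0 ↔ λ(b₀)·T'(b₀) = D'(b₀)`. -/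
theorem eigenvalue_deriv_zero_iff
    (M : ℝ → Matrix (Fin 2) (Fin 2) ℝ) (b₀ : ℝ)
    (hM : ∀ i j : Fin 2, DifferentiableAt ℝ (fun b => M b i j) b₀)
    (lam : ℝ → ℝ) (hlam : DifferentiableAt ℝ lam b₀)
    (heig : ∀ᶠ b in 𝓝 b₀, (M b - lam b • (1 : Matrix (Fin 2) (Fin 2) ℝ)).det = 0)
    (hsimple : 2 * lam b₀ ≠ (M b₀).trace) :
    deriv lam b₀ = 0 ↔
      lam b₀ * deriv (fun b => (M b).trace) b₀ = deriv (fun b => (M b).det) b₀ := by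
  have hT : DifferentiableAt ℝ (fun b => (M b).trace) b₀ := by
    simpa only [Matrix.trace_fin_two] using (hM 0 0).fun_add (hM 1 1)
  have hD : DifferentiableAt ℝ (fun b => (M b).det) b₀ := by
    simpa only [Matrix.det_fin_two] using
      ((hM 0 0).fun_mul (hM 1 1)).fun_sub ((hM 0 1).fun_mul (hM 1 0))
  simp only [det_sub_smul_one_fin_two] at heig
  rw [← sub_eq_zero (a := lam b₀ * _), ← deriv_root_quadratic hT hD hlam heig,
    mul_eq_zero_iff_left (sub_ne_zero.mpr hsimple)]
end
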